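/- Let H be a real Hilbert space, let F : H → H be three times continuously Fréchet differentiable on B(y,R₀) with ‖F''(u)‖ ≤ M₂ and ‖F'''(u)‖ ≤ M₃ there, F(y) = 0, A := F'(y), K(z) := F(y+z) − Az, and assume ‖(A+εI)⁻¹‖ ≤ c/ε for all ε > 0. Let ρ ∈ (0,1] and set R := ε(1−ρ)/(cM₂). Then for all sufficiently small ε > 0, the equation z = −(A+εI)⁻¹K(z) − ε(A+εI)⁻¹(y−w) has at most one solution z in the ball {z : ‖z‖ ≤ R}: if z and v are two solutions with ‖z‖ ≤ R and ‖v‖ ≤ R, then z = v. -/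

import Mathlib

open Metric

/-- If the second derivative of `F` is bounded by `M` on a ball around `y`, then on a smaller closed
ball of radius `R` the map `F` differs from its linearization at `y` by an `M * R`-Lipschitz map. -/
lemma norm_sub_sub_fderiv_le_of_norm_iteratedFDeriv_two_le
    {E G : Type*} [NormedAddCommGroup E] [NormedSpace ℝ E] [NormedAddCommGroup G] [NormedSpace ℝ G]
    {F : E → G} {y : E} {R₀ M R : ℝ} (hM : 0 ≤ M) (hR : R < R₀)
    (hF : ContDiffOn ℝ 2 F (ball y R₀))
    (hF2 : ∀ u ∈ ball y R₀, ‖iteratedFDeriv ℝ 2 F u‖ ≤ M)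
    {a b : E} (ha : a ∈ closedBall y R) (hb : b ∈ closedBall y R) :
    ‖F b - F a - fderiv ℝ F y (b - a)‖ ≤ M * R * ‖b - a‖ := by
  have hcd : ∀ u ∈ ball y R₀, ContDiffAt ℝ 2 F u := fun u hu =>
    hF.contDiffAt (isOpen_ball.mem_nhds hu)
  have hsub : closedBall y R ⊆ ball y R₀ := closedBall_subset_ball hR
  have hR_nonneg : 0 ≤ R := dist_nonneg.trans (mem_closedBall.mp ha)
  have hy : y ∈ ball y R₀ := mem_ball_self (hR_nonneg.trans_lt hR)
  have hlip : ∀ u ∈ closedBall y R, ‖fderiv ℝ F u - fderiv ℝ F y‖ ≤ M * R := by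
    intro u hu
    refine ((convex_ball y R₀).norm_image_sub_le_of_norm_fderiv_le (𝕜 := ℝ) (C := M)
      (fun x hx => ?_) (fun x hx => ?_) hy (hsub hu)).trans ?_
    · exact ((hcd x hx).fderiv_right (m := 1) (by norm_num)).differentiableAt (by norm_num)
    · rw [← norm_iteratedFDeriv_one, norm_iteratedFDeriv_fderiv]
      exact hF2 x hx
    · exact mul_le_mul_of_nonneg_left (mem_closedBall_iff_norm.mp hu) hM
  exact (convex_closedBall y R).norm_image_sub_le_of_norm_fderiv_le' (𝕜 := ℝ)
    (fun x hx => (hcd x (hsub hx)).differentiableAt (by norm_num)) hlip ha hb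

/-- **Uniqueness part of Theorem 2.1.**
Under the hypotheses of Theorem 2.1 (with `ρ ∈ (0,1]` and `R := ε(1-ρ)/(cM₂)`),
for all sufficiently small `ε > 0` the fixed point equation
`z = -(A+εI)⁻¹ K(z) - ε (A+εI)⁻¹ (y-w)` has at most one solution in the closed ball
of radius `R`. -/
theorem singular_perturbation_fixed_point_uniqueness
    {H : Type*} [NormedAddCommGroup H] [InnerProductSpace ℝ H] [CompleteSpace H]
    (F : H → H) (y w : H) (R₀ M₂ M₃ c ρ : ℝ)
    (hR₀ : 0 < R₀) (hM₂ : 0 < M₂) (hM₃ : 0 ≤ M₃) (hc : 0 < c)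
    (hρ : ρ ∈ Set.Ioc (0 : ℝ) 1)
    (hF : ContDiffOn ℝ 3 F (closedBall y R₀))
    (hF2 : ∀ u ∈ closedBall y R₀, ‖iteratedFDeriv ℝ 2 F u‖ ≤ M₂)
    (hF3 : ∀ u ∈ closedBall y R₀, ‖iteratedFDeriv ℝ 3 F u‖ ≤ M₃)
    (hFy : F y = 0)
    (A : H →L[ℝ] H) (hA : A = fderiv ℝ F y)
    (K : H → H) (hK : ∀ z : H, K z = F (y + z) - A z)
    (B : ℝ → H →L[ℝ] H)
    (hB : ∀ ε : ℝ, 0 < ε →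
      (B ε).comp (A + ε • ContinuousLinearMap.id ℝ H) = ContinuousLinearMap.id ℝ H ∧
      (A + ε • ContinuousLinearMap.id ℝ H).comp (B ε) = ContinuousLinearMap.id ℝ H ∧
      ‖B ε‖ ≤ c / ε) :
    ∃ ε₀ > 0, ∀ ε : ℝ, ε ∈ Set.Ioo 0 ε₀ →
      ∀ z v : H, ‖z‖ ≤ ε * (1 - ρ) / (c * M₂) → ‖v‖ ≤ ε * (1 - ρ) / (c * M₂) →
        z = -(B ε) (K z) - ε • (B ε) (y - w) →
        v = -(B ε) (K v) - ε • (B ε) (y - w) →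
        z = v := by
  have hcM : 0 < c * M₂ := mul_pos hc hM₂
  refine ⟨R₀ * (c * M₂), mul_pos hR₀ hcM, ?_⟩
  rintro ε ⟨hε, hε'⟩ z v hz hv hzeq hveq
  set R := ε * (1 - ρ) / (c * M₂) with hRdef
  have hR : R < R₀ := by
    rw [hRdef, div_lt_iff₀ hcM]
    nlinarith [mul_pos hε hρ.1]
  have hKlip : ‖K z - K v‖ ≤ M₂ * R * ‖z - v‖ := by
    have h := norm_sub_sub_fderiv_le_of_norm_iteratedFDeriv_two_le hM₂.le hR
      ((hF.mono ball_subset_closedBall).of_le (by norm_num))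
      (fun u hu => hF2 u (ball_subset_closedBall hu))
      (a := y + v) (b := y + z) (by simpa [mem_closedBall_iff_norm] using hv)
      (by simpa [mem_closedBall_iff_norm] using hz)
    rw [add_sub_add_left_eq_sub, ← hA] at h
    have hK' : K z - K v = F (y + z) - F (y + v) - A (z - v) := by
      rw [hK, hK, map_sub]
      abel
    rwa [hK']
  have hdiff : z - v = -(B ε) (K z - K v) := by
    rw [map_sub]
    nth_rewrite 1 [hzeq, hveq]
    abel
  have hcontr : ‖z - v‖ ≤ (1 - ρ) * ‖z - v‖ :=
    calc ‖z - v‖ = ‖(B ε) (K z - K v)‖ := by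
          nth_rewrite 1 [hdiff]
          exact norm_neg _
      _ ≤ c / ε * (M₂ * R * ‖z - v‖) :=
          (B ε).le_of_opNorm_le_of_le (hB ε hε).2.2 hKlip
      _ = (1 - ρ) * ‖z - v‖ := by
          rw [hRdef]
          field_simp
  have hnorm : ‖z - v‖ ≤ 0 := by nlinarith [norm_nonneg (z - v), hρ.1]
  exact sub_eq_zero.mp (norm_le_zero_iff.mp hnorm)
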